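/- arXiv:2307.09201 — 3 statements merged into one kernel-verified Lean document; each statement's English description precedes it below -/
import Mathlib

section
/- There exists ε₀ > 0 such that for every ε ∈ [0, ε₀] the following holds: there exist t₀ < t_max < ∞, constants c₁, c₂ > 0, and a C¹ solution (χ, u₁, u₂, w₁, w₂) : [t₀, t_max) → ℝ⁵ of the system χ' = ε, u₁' = u₁² − u₂ − χu₁ − w₁, u₂' = (1/3)u₁³ − u₁ − χu₂ − w₂, w₁' = −εu₁, w₂' = −εu₂, such that u₁(t)·(t_max − t) → c₁ and u₂(t)·(t_max − t)² → c₂ as t → t_max⁻. In particular this system admits solutions blowing up in finite time with rates u₁(t) ∼ c₁(t_max − t)^{−1}, u₂(t) ∼ c₂(t_max − t)^{−2}. -/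
open Real Set Filter Topology

theorem kk_fuchs {E : Type*} [NormedAddCommGroup E] [NormedSpace ℝ E] [CompleteSpace E]
    (F : ℝ × E → E) (hF : Continuous F) (h0 : F (0, 0) = 0) (L R δ₀ : ℝ) (hL0 : 0 ≤ L)
    (hL : L < 10) (hR : 0 < R) (hδ₀ : 0 < δ₀)
    (hlip : ∀ θ ∈ Icc 0 δ₀, ∀ y z : E, ‖y‖ ≤ R → ‖z‖ ≤ R →
      ‖F (θ, y) - F (θ, z)‖ ≤ L * ‖y - z‖) :
    ∃ δ > 0, ∃ y : ℝ → E, Continuous y ∧ ∀ θ ∈ Ioo 0 δ,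
      HasDerivAt y (θ⁻¹ • (F (θ, y θ) - (10:ℝ) • y θ)) θ := by
  obtain ⟨δ, hδ, hδle, hsmall⟩ : ∃ δ > 0, δ ≤ δ₀ ∧ ∀ θ ∈ Icc 0 δ, ‖F (θ, 0)‖ ≤ (10 - L) * R := by
    have hc : Continuous fun θ : ℝ => ‖F (θ, 0)‖ := by fun_prop
    have h1 : ∀ᶠ θ in 𝓝 (0:ℝ), ‖F (θ, 0)‖ < (10 - L) * R := by
      apply hc.continuousAt.eventually_lt continuousAt_const
      simp only [h0, norm_zero]
      exact mul_pos (by linarith) hR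
    obtain ⟨d, hd, h⟩ := Metric.eventually_nhds_iff.1 h1
    refine ⟨min (d/2) δ₀, by positivity, min_le_right _ _, fun θ hθ => (h ?_).le⟩
    rw [Real.dist_eq, sub_zero, abs_of_nonneg hθ.1]
    linarith [hθ.2, min_le_left (d/2) δ₀]
  have hbd : ∀ θ ∈ Icc 0 δ, ∀ y : E, ‖y‖ ≤ R → ‖F (θ, y)‖ ≤ 10 * R := by
    intro θ hθ y hy
    have h1 := hlip θ ⟨hθ.1, hθ.2.trans hδle⟩ y 0 hy (by simpa using hR.le)
    have h2 := hsmall θ hθ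
    have h3 : ‖F (θ, y)‖ ≤ ‖F (θ, y) - F (θ, 0)‖ + ‖F (θ, 0)‖ := by
      simpa using norm_add_le (F (θ, y) - F (θ, 0)) (F (θ, 0))
    rw [sub_zero] at h1
    nlinarith
  let ext : C(Icc 0 δ, E) → ℝ → E := fun Y => IccExtend hδ.le Y
  have hext : ∀ Y, Continuous (ext Y) := fun Y => Y.continuous.Icc_extend'
  let T : C(Icc 0 δ, E) → C(Icc 0 δ, E) := fun Y =>
    ⟨fun θ => ∫ x in (0:ℝ)..1, x ^ 9 • F ((θ:ℝ) * x, ext Y (θ * x)), by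
      apply intervalIntegral.continuous_parametric_intervalIntegral_of_continuous'
      have := hext Y
      simp only [Function.uncurry_def]
      fun_prop⟩
  have hint : ∀ C : ℝ, ∀ f : ℝ → E, (∀ x ∈ Icc (0:ℝ) 1, ‖f x‖ ≤ 10 * C) →
      ‖∫ x in (0:ℝ)..1, x ^ 9 • f x‖ ≤ C := by
    intro C f hf
    have h1 : ‖∫ x in (0:ℝ)..1, x ^ 9 • f x‖ ≤ ∫ x in (0:ℝ)..1, x ^ 9 * (10 * C) := by
      apply intervalIntegral.norm_integral_le_of_norm_le zero_le_one
      · refine Filter.Eventually.of_forall fun x hx => ?_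
        rw [norm_smul, Real.norm_of_nonneg (pow_nonneg hx.1.le _)]
        exact mul_le_mul_of_nonneg_left (hf x ⟨hx.1.le, hx.2⟩) (pow_nonneg hx.1.le _)
      · exact Continuous.intervalIntegrable (by fun_prop) _ _
    refine h1.trans (le_of_eq ?_)
    rw [intervalIntegral.integral_mul_const, integral_pow]
    norm_num
    ring
  let S : Set C(Icc 0 δ, E) := Metric.closedBall 0 R
  have hSn : ∀ Y ∈ S, ∀ s, ‖ext Y s‖ ≤ R := by
    intro Y hY s
    have : ‖Y‖ ≤ R := by simpa [S] using hY
    exact (Y.norm_coe_le_norm _).trans this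
  have hmem : ∀ θ : Icc 0 δ, ∀ x ∈ Icc (0:ℝ) 1, (θ:ℝ) * x ∈ Icc 0 δ := by
    intro θ x hx
    refine ⟨mul_nonneg θ.2.1 hx.1, ?_⟩
    have := θ.2.1
    have := θ.2.2
    nlinarith [hx.1, hx.2]
  have hmaps : MapsTo T S S := by
    intro Y hY
    have : ‖T Y‖ ≤ R := by
      rw [ContinuousMap.norm_le _ hR.le]
      intro θ
      exact hint R _ fun x hx => hbd _ (hmem θ x hx) _ (hSn Y hY _)
    simpa [S] using this
  have hScomp : IsComplete S := Metric.isClosed_closedBall.isComplete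
  obtain ⟨K, hK⟩ : ∃ K : NNReal, (K:ℝ) = L / 10 := ⟨⟨L / 10, by positivity⟩, rfl⟩
  have hcon : ContractingWith K (hmaps.restrict T S S) := by
    refine ⟨?_, ?_⟩
    · rw [← NNReal.coe_lt_coe]
      rw [hK, NNReal.coe_one]
      linarith
    · apply LipschitzWith.of_dist_le_mul
      rintro ⟨Y, hY⟩ ⟨Z, hZ⟩
      rw [hK]
      change dist (T Y) (T Z) ≤ L / 10 * dist Y Z
      rw [ContinuousMap.dist_le (by positivity)]
      intro θ
      rw [dist_eq_norm]
      change ‖(∫ x in (0:ℝ)..1, x ^ 9 • F ((θ:ℝ) * x, ext Y (θ * x))) -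
        ∫ x in (0:ℝ)..1, x ^ 9 • F ((θ:ℝ) * x, ext Z (θ * x))‖ ≤ _
      have hY' := hext Y
      have hZ' := hext Z
      rw [← intervalIntegral.integral_sub (Continuous.intervalIntegrable (by fun_prop) _ _)
        (Continuous.intervalIntegrable (by fun_prop) _ _)]
      simp only [← smul_sub]
      apply hint
      intro x hx
      have hm := hmem θ x hx
      refine (hlip _ ⟨hm.1, hm.2.trans hδle⟩ _ _ (hSn Y hY _) (hSn Z hZ _)).trans ?_
      have : ‖ext Y (θ * x) - ext Z (θ * x)‖ ≤ dist Y Z := by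
        rw [← dist_eq_norm]
        exact ContinuousMap.dist_apply_le_dist _
      nlinarith
  obtain ⟨Y, hYS, hfix, -⟩ := ContractingWith.exists_fixedPoint' hScomp hmaps hcon
    (x := 0) (by simp [S, hR.le]) (edist_ne_top _ _)
  refine ⟨δ, hδ, ext Y, hext Y, fun θ hθ => ?_⟩
  have hY' := hext Y
  have hf : Continuous fun s : ℝ => s ^ 9 • F (s, ext Y s) := by fun_prop
  have hform : ∀ s ∈ Ioo 0 δ, ext Y s = (s ^ 10)⁻¹ • ∫ r in (0:ℝ)..s, r ^ 9 • F (r, ext Y r) := by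
    intro s hs
    have hs' : s ∈ Icc 0 δ := Ioo_subset_Icc_self hs
    have h1 : ext Y s = Y ⟨s, hs'⟩ := IccExtend_of_mem _ _ hs'
    have h2 : Y ⟨s, hs'⟩ = ∫ x in (0:ℝ)..1, x ^ 9 • F (s * x, ext Y (s * x)) := by
      conv_lhs => rw [← hfix.eq]
      rfl
    rw [h1, h2]
    have h3 := intervalIntegral.integral_comp_mul_left (a := 0) (b := 1)
      (fun r : ℝ => r ^ 9 • F (r, ext Y r)) hs.1.ne'
    simp only [mul_zero, mul_one, mul_pow, mul_smul] at h3
    rw [intervalIntegral.integral_smul] at h3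
    have h4 : (s ^ 10)⁻¹ = (s ^ 9)⁻¹ * s⁻¹ := by
      rw [← mul_inv]
      ring
    rw [h4, mul_smul, ← h3, smul_smul, inv_mul_cancel₀ (pow_ne_zero _ hs.1.ne'), one_smul]
  have hev : ext Y =ᶠ[𝓝 θ] fun s => (s ^ 10)⁻¹ • ∫ r in (0:ℝ)..s, r ^ 9 • F (r, ext Y r) := by
    filter_upwards [Ioo_mem_nhds hθ.1 hθ.2] with s hs using hform s hs
  refine HasDerivAt.congr_of_eventuallyEq ?_ hev
  have hθ0 : θ ≠ 0 := hθ.1.ne'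
  have hd1 : HasDerivAt (fun s : ℝ => ∫ r in (0:ℝ)..s, r ^ 9 • F (r, ext Y r))
      (θ ^ 9 • F (θ, ext Y θ)) θ :=
    intervalIntegral.integral_hasDerivAt_right (hf.intervalIntegrable _ _)
      (hf.stronglyMeasurableAtFilter _ _) hf.continuousAt
  have hd2 : HasDerivAt (fun s : ℝ => (s ^ 10)⁻¹) (-(10 * θ ^ 9) / (θ ^ 10) ^ 2) θ := by
    simpa using (hasDerivAt_pow 10 θ).fun_inv (pow_ne_zero _ hθ0)
  refine (hd2.smul hd1).congr_deriv ?_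
  have h5 : (∫ r in (0:ℝ)..θ, r ^ 9 • F (r, ext Y r)) = θ ^ 10 • ext Y θ := by
    rw [hform θ hθ, smul_smul, mul_inv_cancel₀ (pow_ne_zero _ hθ0), one_smul]
  rw [h5, smul_smul, smul_smul, smul_sub, smul_smul]
  have e1 : (θ ^ 10)⁻¹ * θ ^ 9 = θ⁻¹ := by field_simp
  have e2 : -(10 * θ ^ 9) / (θ ^ 10) ^ 2 * θ ^ 10 = -(θ⁻¹ * 10) := by field_simp
  rw [e1, e2, neg_smul]
  abel

theorem kk_fst {A B : Type*} [NormedAddCommGroup A] [NormedSpace ℝ A] [NormedAddCommGroup B]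
    [NormedSpace ℝ B] {y : ℝ → A × B} {D : A × B} {θ : ℝ} (h : HasDerivAt y D θ) :
    HasDerivAt (fun s => (y s).1) D.1 θ :=
  (ContinuousLinearMap.fst ℝ A B).hasFDerivAt.comp_hasDerivAt θ h

theorem kk_snd {A B : Type*} [NormedAddCommGroup A] [NormedSpace ℝ A] [NormedAddCommGroup B]
    [NormedSpace ℝ B] {y : ℝ → A × B} {D : A × B} {θ : ℝ} (h : HasDerivAt y D θ) :
    HasDerivAt (fun s => (y s).2) D.2 θ :=
  (ContinuousLinearMap.snd ℝ A B).hasFDerivAt.comp_hasDerivAt θ h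

theorem kk_reduced (ε c : ℝ) (hc : c = 3 + √3) :
    ∃ δ > 0, ∃ y₁ y₂ n m : ℝ → ℝ, Continuous y₁ ∧ Continuous y₂ ∧ ∀ θ ∈ Ioo 0 δ,
      HasDerivAt y₁ (θ⁻¹ * (-(4 * c + 1) * y₁ θ + 2 * y₂ θ + 2 * θ *
        (-θ ^ 2 * y₁ θ ^ 2 - ε * c - ε * θ ^ 3 * y₁ θ + ε * θ * m θ + 2 * ε * c * log θ))) θ ∧
      HasDerivAt y₂ (θ⁻¹ * (-2 * c ^ 2 * y₁ θ + y₂ θ + 2 * θ *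
        (-c * θ ^ 2 * y₁ θ ^ 2 + c - 2 * ε * (5 * c - 6) - ε * θ ^ 3 * y₂ θ + 10 * ε * θ ^ 3 * n θ
          + θ ^ 2 * (θ * y₁ θ - θ ^ 3 * y₁ θ ^ 3 / 3)))) θ ∧
      HasDerivAt n (θ⁻¹ * (-n θ + y₂ θ / 5)) θ ∧
      HasDerivAt m (θ⁻¹ * (-m θ + 2 * θ ^ 2 * y₁ θ)) θ := by
  have hs : √3 ^ 2 = 3 := Real.sq_sqrt (by norm_num)
  have hs0 : 0 ≤ √3 := Real.sqrt_nonneg 3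
  have hs1 : (17/10:ℝ) ≤ √3 := by nlinarith
  have hs2 : √3 ≤ 18/10 := by nlinarith
  have hcc : c ^ 2 = 6 * c - 6 := by rw [hc]; nlinarith
  have hd : 4 ≤ 2 * c - 5 := by linarith
  obtain ⟨d, hdd⟩ : ∃ d, d = (2 * c - 5)⁻¹ := ⟨_, rfl⟩
  have hd0 : 0 ≤ d := by rw [hdd]; positivity
  have hd1 : d ≤ 1 / 4 := by
    rw [hdd, one_div]
    exact inv_anti₀ (by norm_num) hd
  have hd2 : d * (2 * c - 5) = 1 := by rw [hdd]; exact inv_mul_cancel₀ (by linarith)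
  let Y₁ : (ℝ × ℝ × ℝ × ℝ) → ℝ := fun v => (v.2.1 - v.1) * d
  let Y₂ : (ℝ × ℝ × ℝ × ℝ) → ℝ := fun v => 3 * Y₁ v - v.1
  let h₁ : ℝ × (ℝ × ℝ × ℝ × ℝ) → ℝ := fun x => -x.1 ^ 2 * Y₁ x.2 ^ 2 - ε * c - ε * x.1 ^ 3 * Y₁ x.2
    + ε * x.1 * x.2.2.2.2
  let h₂ : ℝ × (ℝ × ℝ × ℝ × ℝ) → ℝ := fun x => -c * x.1 ^ 2 * Y₁ x.2 ^ 2 + c - 2 * ε * (5 * c - 6)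
    - ε * x.1 ^ 3 * Y₂ x.2 + 10 * ε * x.1 ^ 3 * x.2.2.2.1
    + x.1 ^ 2 * (x.1 * Y₁ x.2 - x.1 ^ 3 * Y₁ x.2 ^ 3 / 3)
  let H : ℝ × (ℝ × ℝ × ℝ × ℝ) → (ℝ × ℝ × ℝ × ℝ) := fun x => (2 * (3 * h₁ x - h₂ x), 2 * ((2 * c - 2) * h₁ x - h₂ x), 0,
    2 * x.1 * Y₁ x.2)
  let N : (ℝ × ℝ × ℝ × ℝ) → (ℝ × ℝ × ℝ × ℝ) := fun v => (5 * v.1, (15 - 4 * c) * v.2.1, 9 * v.2.2.1 + Y₂ v / 5, 9 * v.2.2.2)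
  let g : ℝ → (ℝ × ℝ × ℝ × ℝ) := fun θ => (12 * ε * c * (θ * log θ), (2 * c - 2) * (4 * ε * c) * (θ * log θ), 0, 0)
  have hHs : ContDiff ℝ 1 H := by
    simp only [H, h₁, h₂, Y₂, Y₁]
    fun_prop
  have hNc : Continuous N := by
    simp only [N, Y₂, Y₁]
    fun_prop
  have hgc : Continuous g := by
    have := Real.continuous_mul_log
    simp only [g]
    fun_prop
  have hNlip : ∀ v w : (ℝ × ℝ × ℝ × ℝ), ‖N v - N w‖ ≤ (97/10) * ‖v - w‖ := by
    intro v w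
    obtain ⟨r, hr⟩ : ∃ r, r = ‖v - w‖ := ⟨_, rfl⟩
    have hr0 : 0 ≤ r := hr ▸ norm_nonneg _
    have hle : ‖v - w‖ ≤ r := hr.ge
    rw [← hr]
    obtain ⟨a, b, e, f⟩ := v
    obtain ⟨a', b', e', f'⟩ := w
    simp only [N, Y₂, Y₁, Prod.mk_sub_mk, Prod.norm_mk, Real.norm_eq_abs, max_le_iff, abs_le] at hle ⊢
    obtain ⟨⟨ha1, ha2⟩, ⟨hb1, hb2⟩, ⟨he1, he2⟩, hf1, hf2⟩ := hle
    have k1 : |((b - b') - (a - a')) * d| ≤ (2 * r) * (1/4) := by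
      rw [abs_mul, abs_of_nonneg hd0]
      gcongr
      rw [abs_le]
      constructor <;> linarith
    rw [abs_le] at k1
    have k2 : |(15 - 4 * c) * (b - b')| ≤ 5 * r := by
      rw [abs_mul]
      have : |15 - 4 * c| ≤ 5 := by rw [abs_le]; constructor <;> linarith
      have : |b - b'| ≤ r := by rw [abs_le]; constructor <;> linarith
      gcongr
    rw [abs_le] at k2
    refine ⟨⟨?_, ?_⟩, ⟨?_, ?_⟩, ⟨?_, ?_⟩, ?_, ?_⟩ <;> linarith
  let F : ℝ × (ℝ × ℝ × ℝ × ℝ) → (ℝ × ℝ × ℝ × ℝ) := fun x => N x.2 + x.1 • H x + g x.1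
  have hFc : Continuous F := by
    have := hHs.continuous
    simp only [F]
    fun_prop
  have hF0 : F (0, 0) = 0 := by
    simp [F, N, g, Y₁, Y₂]
  obtain ⟨K, t, ht, hKt⟩ := (hHs.contDiffAt (x := ((0:ℝ), (0:(ℝ × ℝ × ℝ × ℝ))))).exists_lipschitzOnWith
  obtain ⟨r, hr, hrt⟩ := Metric.mem_nhds_iff.1 ht
  obtain ⟨δ, hδ, y, hy, hder⟩ := kk_fuchs F hFc hF0 (98/10) (r/2) (min (r/2) (1 / (10 * (K + 1))))
    (by norm_num) (by norm_num) (by positivity) (by positivity) (by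
      intro θ hθ v w hv hw
      have hθr : θ ≤ r / 2 := hθ.2.trans (min_le_left _ _)
      have hθK : θ ≤ 1 / (10 * (K + 1)) := hθ.2.trans (min_le_right _ _)
      have hθ0 := hθ.1
      have hin : ∀ u : (ℝ × ℝ × ℝ × ℝ), ‖u‖ ≤ r / 2 → (θ, u) ∈ t := by
        intro u hu
        apply hrt
        rw [Metric.mem_ball, Prod.dist_eq, max_lt_iff]
        simp only [dist_zero_right, Real.norm_eq_abs, abs_of_nonneg hθ0]
        constructor <;> linarith
      have h1 := hKt.norm_sub_le (hin v hv) (hin w hw)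
      have h2 : ‖((θ, v) : ℝ × (ℝ × ℝ × ℝ × ℝ)) - (θ, w)‖ = ‖v - w‖ := by
        rw [Prod.mk_sub_mk, sub_self, Prod.norm_mk, norm_zero, max_eq_right (norm_nonneg _)]
      rw [h2] at h1
      have h3 : F (θ, v) - F (θ, w) = (N v - N w) + θ • (H (θ, v) - H (θ, w)) := by
        simp only [F, smul_sub]
        abel
      rw [h3]
      refine (norm_add_le _ _).trans ?_
      rw [norm_smul, Real.norm_of_nonneg hθ0]
      have h4 : θ * K ≤ 1 / 10 := by
        rw [le_div_iff₀ (by positivity)] at hθK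
        nlinarith
      have h5 : θ * ‖H (θ, v) - H (θ, w)‖ ≤ θ * (K * ‖v - w‖) := by gcongr
      have h6 := hNlip v w
      have h7 := mul_le_mul_of_nonneg_right h4 (norm_nonneg (v - w))
      nlinarith)
  refine ⟨δ, hδ, fun s => Y₁ (y s), fun s => Y₂ (y s), fun s => (y s).2.2.1, fun s => (y s).2.2.2,
    ?_, ?_, ?_⟩
  · simp only [Y₁]; fun_prop
  · simp only [Y₂, Y₁]; fun_prop
  intro θ hθ
  have hD := hder θ hθ
  have hθ0 : θ ≠ 0 := hθ.1.ne'
  have p1 := kk_fst hD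
  have q0 := kk_snd hD
  have q1 := kk_fst q0
  have n1 := kk_fst (kk_snd q0)
  have m1 := kk_snd (kk_snd q0)
  obtain ⟨mm, hmm⟩ : ∃ p, p = (y θ).2.2.2 := ⟨_, rfl⟩
  have hY1 := (q1.fun_sub p1).mul_const d
  have hY2 := (hY1.const_mul 3).fun_sub p1
  obtain ⟨ℓ, hℓ⟩ : ∃ p, p = log θ := ⟨_, rfl⟩
  obtain ⟨p, hp⟩ : ∃ p, p = (y θ).1 := ⟨_, rfl⟩
  obtain ⟨q, hq⟩ : ∃ q, q = (y θ).2.1 := ⟨_, rfl⟩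
  refine ⟨hY1.congr_deriv ?_, hY2.congr_deriv ?_, n1.congr_deriv ?_, m1.congr_deriv ?_⟩
  · simp only [F, N, H, g, h₁, h₂, Y₁, Y₂, Prod.fst_add, Prod.snd_add, Prod.smul_fst, Prod.smul_snd,
      Prod.fst_sub, Prod.snd_sub, smul_eq_mul, ← hp, ← hq, ← hmm, ← hℓ]
    linear_combination θ⁻¹ * (2 * θ * (-θ ^ 2 * ((q-p)*d) ^ 2 - ε * c - ε * θ ^ 3 * ((q-p)*d) + ε * θ * mm + 2 * ε * c * ℓ) - 2 * p) * hd2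
  · simp only [F, N, H, g, h₁, h₂, Y₁, Y₂, Prod.fst_add, Prod.snd_add, Prod.smul_fst, Prod.smul_snd,
      Prod.fst_sub, Prod.snd_sub, smul_eq_mul, ← hp, ← hq, ← hmm, ← hℓ]
    linear_combination 3 * (θ⁻¹ * (2 * θ * (-θ ^ 2 * ((q-p)*d) ^ 2 - ε * c - ε * θ ^ 3 * ((q-p)*d) + ε * θ * mm + 2 * ε * c * ℓ) - 2 * p)) * hd2 + θ⁻¹ * 2 * ((q - p) * d) * hcc
  · simp only [F, N, H, g, h₁, h₂, Y₁, Y₂, Prod.fst_add, Prod.snd_add, Prod.smul_fst, Prod.smul_snd,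
      Prod.fst_sub, Prod.snd_sub, smul_eq_mul]
    ring
  · simp only [F, N, H, g, h₁, h₂, Y₁, Y₂, Prod.fst_add, Prod.snd_add, Prod.smul_fst, Prod.smul_snd,
      Prod.fst_sub, Prod.snd_sub, smul_eq_mul]
    ring

theorem keyfitz_kranzer_blowup_exists :
    ∃ ε₀ : ℝ, 0 < ε₀ ∧ ∀ ε ∈ Icc (0 : ℝ) ε₀,
      ∃ t₀ tmax : ℝ, t₀ < tmax ∧ ∃ c₁ c₂ : ℝ, 0 < c₁ ∧ 0 < c₂ ∧
        ∃ χ u₁ u₂ w₁ w₂ : ℝ → ℝ,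
          (∀ t ∈ Ico t₀ tmax,
            HasDerivWithinAt χ ε (Ico t₀ tmax) t ∧
            HasDerivWithinAt u₁
              (u₁ t ^ 2 - u₂ t - χ t * u₁ t - w₁ t) (Ico t₀ tmax) t ∧
            HasDerivWithinAt u₂
              ((1 / 3) * u₁ t ^ 3 - u₁ t - χ t * u₂ t - w₂ t) (Ico t₀ tmax) t ∧
            HasDerivWithinAt w₁ (-(ε * u₁ t)) (Ico t₀ tmax) t ∧
            HasDerivWithinAt w₂ (-(ε * u₂ t)) (Ico t₀ tmax) t) ∧
          Tendsto (fun t => u₁ t * (tmax - t)) (𝓝[<] tmax) (𝓝 c₁) ∧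
          Tendsto (fun t => u₂ t * (tmax - t) ^ 2) (𝓝[<] tmax) (𝓝 c₂) := by
  refine ⟨1, one_pos, fun ε _ => ?_⟩
  obtain ⟨c, hc⟩ : ∃ c : ℝ, c = 3 + √3 := ⟨_, rfl⟩
  have hs : √3 ^ 2 = 3 := Real.sq_sqrt (by norm_num)
  have hs0 : 0 ≤ √3 := Real.sqrt_nonneg 3
  have hcc : c ^ 2 = 6 * c - 6 := by rw [hc]; nlinarith
  obtain ⟨δ, hδ, y₁, y₂, n, m, hy₁, hy₂, hD⟩ := kk_reduced ε c hc
  have hth : Tendsto (fun t : ℝ => √(-t)) (𝓝[<] 0) (𝓝 0) := by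
    have : Continuous fun t : ℝ => √(-t) := by fun_prop
    have h := this.tendsto 0
    simp only [neg_zero, Real.sqrt_zero] at h
    exact h.mono_left nhdsWithin_le_nhds
  refine ⟨-(δ / 2) ^ 2, 0, by nlinarith, c, 5 * c - 6, by linarith, by linarith,
    fun t => ε * t,
    fun t => c / √(-t) ^ 2 + √(-t) * y₁ (√(-t)),
    fun t => (5 * c - 6) / √(-t) ^ 4 + y₂ (√(-t)) / √(-t),
    fun t => 2 * ε * c * log (√(-t)) + ε * √(-t) * m (√(-t)),
    fun t => -(ε * (5 * c - 6)) / √(-t) ^ 2 + 10 * ε * √(-t) * n (√(-t)), ?_, ?_, ?_⟩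
  · intro t ht
    obtain ⟨θ, hθ⟩ : ∃ θ, θ = √(-t) := ⟨_, rfl⟩
    have ht0 : 0 < -t := by linarith [ht.2]
    have hθp : 0 < θ := hθ ▸ Real.sqrt_pos.2 ht0
    have hθ0 := hθp.ne'
    have hθsq : θ ^ 2 = -t := hθ ▸ Real.sq_sqrt ht0.le
    have htt : t = -θ ^ 2 := by linarith
    have hθδ : θ < δ := by
      have := ht.1
      nlinarith
    obtain ⟨d1, d2, d3, d4⟩ := hD θ ⟨hθp, hθδ⟩
    have dθ : HasDerivAt (fun t : ℝ => √(-t)) (-1 / (2 * θ)) t := by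
      have := (hasDerivAt_neg t).sqrt ht0.ne'
      rwa [← hθ] at this
    have key : ∀ (f : ℝ → ℝ) (f' a : ℝ), HasDerivAt f f' θ → f' * (-1 / (2 * θ)) = a →
        HasDerivWithinAt (fun t => f (√(-t))) a (Ico (-(δ / 2) ^ 2) 0) t := by
      intro f f' a hf ha
      rw [hθ] at hf
      rw [← ha]
      exact (HasDerivAt.comp t hf dθ).hasDerivWithinAt
    have dinv2 : ∀ a : ℝ, HasDerivAt (fun s : ℝ => a / s ^ 2) (-2 * a / θ ^ 3) θ := by
      intro a
      refine ((hasDerivAt_const θ a).fun_div (hasDerivAt_pow 2 θ) (by positivity)).congr_deriv ?_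
      field_simp
      ring
    have dinv4 : ∀ a : ℝ, HasDerivAt (fun s : ℝ => a / s ^ 4) (-4 * a / θ ^ 5) θ := by
      intro a
      refine ((hasDerivAt_const θ a).fun_div (hasDerivAt_pow 4 θ) (by positivity)).congr_deriv ?_
      field_simp
      ring
    have did := hasDerivAt_id' θ
    refine ⟨?_, ?_, ?_, ?_, ?_⟩
    · simpa using ((hasDerivAt_id' t).const_mul ε).hasDerivWithinAt
    · refine key (fun s => c / s ^ 2 + s * y₁ s) _ _ ((dinv2 c).fun_add (did.fun_mul d1)) ?_
      simp only [← hθ]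
      rw [htt]
      field_simp
      linear_combination (-2:ℝ) * hcc
    · refine key (fun s => (5 * c - 6) / s ^ 4 + y₂ s / s) _ _
        ((dinv4 _).fun_add (d2.fun_div did hθ0)) ?_
      simp only [← hθ]
      rw [htt]
      field_simp
      linear_combination (-2:ℝ) * (c + 6) * hcc
    · refine key (fun s => 2 * ε * c * log s + ε * s * m s) _ _
        (((Real.hasDerivAt_log hθ0).const_mul _).fun_add ((did.const_mul ε).fun_mul d4)) ?_
      simp only [← hθ]
      field_simp
      ring
    · refine key (fun s => -(ε * (5 * c - 6)) / s ^ 2 + 10 * ε * s * n s) _ _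
        ((dinv2 _).fun_add ((did.const_mul (10 * ε)).fun_mul d3)) ?_
      simp only [← hθ]
      field_simp
      ring
  · have hcont : Tendsto (fun t : ℝ => c + √(-t) ^ 3 * y₁ (√(-t))) (𝓝[<] 0) (𝓝 c) := by
      have h := (show Continuous fun s : ℝ => c + s ^ 3 * y₁ s by fun_prop).tendsto 0
      simpa [Function.comp_def] using h.comp hth
    refine hcont.congr' ?_
    filter_upwards [self_mem_nhdsWithin] with t ht
    have ht0 : 0 < -t := by linarith [mem_Iio.1 ht]
    have hθ0 := (Real.sqrt_pos.2 ht0).ne'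
    have e : (0 - t) = √(-t) ^ 2 := by rw [Real.sq_sqrt ht0.le]; ring
    rw [e]
    field_simp
  · have hcont : Tendsto (fun t : ℝ => (5 * c - 6) + √(-t) ^ 3 * y₂ (√(-t))) (𝓝[<] 0)
        (𝓝 (5 * c - 6)) := by
      have h := (show Continuous fun s : ℝ => (5 * c - 6) + s ^ 3 * y₂ s by fun_prop).tendsto 0
      simpa [Function.comp_def] using h.comp hth
    refine hcont.congr' ?_
    filter_upwards [self_mem_nhdsWithin] with t ht
    have ht0 : 0 < -t := by linarith [mem_Iio.1 ht]
    have hθ0 := (Real.sqrt_pos.2 ht0).ne'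
    have e : (0 - t) = √(-t) ^ 2 := by rw [Real.sq_sqrt ht0.le]; ring
    rw [e]
    field_simp
end

section
/- Let m < 0, β < 0 and α ∈ ℝ. Then there exist 0 < χ₀ < χ_max < ∞, constants c_u, c_v > 0, and a twice continuously differentiable positive function u : [χ₀, χ_max) → (0, ∞) satisfying (u(χ)^{m−1}·u'(χ))' + βχ·u'(χ) + α·u(χ) = 0 for all χ ∈ [χ₀, χ_max), such that u(χ)·(χ_max − χ)^{1/(1−m)} → c_u and u(χ)^{m−1}·u'(χ)·(χ_max − χ)^{1/(1−m)} → c_v as χ → χ_max⁻. In particular the self-similar profile equation admits solutions blowing up at a finite χ_max with rate u(χ) ∼ c_u·(χ_max − χ)^{−1/(1−m)}. -/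
open Real Set Filter Topology

lemma ode_core (B k A : ℝ) (hB : 0 < B) (hk : 0 < k) :
    ∃ ε > 0, ∃ Y r : ℝ → ℝ, Y 0 = 0 ∧ r 0 = 0 ∧ ContinuousOn Y (Icc 0 ε) ∧
      ContinuousOn r (Icc 0 ε) ∧ Y ε < 1 ∧
      (∀ t ∈ Icc 0 ε, 0 < B * (1 - Y t) + t ^ (1 / k) * r t) ∧
      (∀ t ∈ Ioo 0 ε, HasDerivAt Y (t ^ (1 / k) / (k * (B * (1 - Y t) + t ^ (1 / k) * r t))) t) ∧
      (∀ t ∈ Ioo 0 ε, HasDerivAt r (A / (k * (B * (1 - Y t) + t ^ (1 / k) * r t))) t) := by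
  set G : ℝ → ℝ × ℝ → ℝ := fun t x => (max (B / 2) (B * (1 - x.1) + t ^ (1 / k) * x.2))⁻¹ with hG
  set F : ℝ → ℝ × ℝ → ℝ × ℝ := fun t x => (t ^ (1 / k) / k * G t x, A / k * G t x) with hF
  have h1k : 0 < 1 / k := by positivity
  have hs : Continuous (fun t : ℝ => t ^ (1 / k)) := Real.continuous_rpow_const h1k.le
  have hmpos : ∀ z, 0 < max (B / 2) z := fun z => lt_max_of_lt_left (by positivity)
  have hG0 : ∀ t x, 0 ≤ G t x := fun t x => (inv_pos.2 (hmpos _)).le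
  have hGle : ∀ t x, G t x ≤ 2 / B := by
    intro t x
    have : G t x ≤ (B / 2)⁻¹ := inv_anti₀ (by positivity) (le_max_left _ _)
    simpa using this
  have hinv : ∀ y z : ℝ, |(max (B / 2) y)⁻¹ - (max (B / 2) z)⁻¹| ≤ 4 / B ^ 2 * |y - z| := by
    intro y z
    have h1 := hmpos y
    have h2 := hmpos z
    have e : (max (B / 2) y)⁻¹ - (max (B / 2) z)⁻¹ =
        (max (B / 2) z - max (B / 2) y) * ((max (B / 2) y)⁻¹ * (max (B / 2) z)⁻¹) := by
      field_simp
    have i1 : (max (B / 2) y)⁻¹ ≤ (B / 2)⁻¹ := inv_anti₀ (by positivity) (le_max_left _ _)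
    have i2 : (max (B / 2) z)⁻¹ ≤ (B / 2)⁻¹ := inv_anti₀ (by positivity) (le_max_left _ _)
    rw [e, abs_mul, abs_of_pos (by positivity : 0 < (max (B / 2) y)⁻¹ * (max (B / 2) z)⁻¹), mul_comm]
    have i3 : |max (B / 2) z - max (B / 2) y| ≤ |y - z| := by
      have := abs_max_sub_max_le_abs z y (B / 2)
      rw [max_comm z, max_comm y, abs_sub_comm z y] at this
      exact this
    have i4 : (max (B / 2) y)⁻¹ * (max (B / 2) z)⁻¹ ≤ 4 / B ^ 2 := by
      calc _ ≤ (B / 2)⁻¹ * (B / 2)⁻¹ := by gcongr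
        _ = _ := by field_simp; norm_num
    gcongr
  have hs1 : ∀ t ∈ Icc (0:ℝ) 1, 0 ≤ t ^ (1 / k) ∧ t ^ (1 / k) ≤ 1 := fun t ht =>
    ⟨Real.rpow_nonneg ht.1 _, Real.rpow_le_one ht.1 ht.2 h1k.le⟩
  have hGlip : ∀ t ∈ Icc (0:ℝ) 1, ∀ x y, |G t x - G t y| ≤ 4 / B ^ 2 * (B + 1) * dist x y := by
    intro t ht x y
    obtain ⟨s0, s1⟩ := hs1 t ht
    refine (hinv _ _).trans ?_
    rw [mul_assoc]
    refine mul_le_mul_of_nonneg_left ?_ (by positivity)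
    have d1 : |x.1 - y.1| ≤ dist x y := le_max_left _ _
    have d2 : |x.2 - y.2| ≤ dist x y := le_max_right _ _
    have e : B * (1 - x.1) + t ^ (1 / k) * x.2 - (B * (1 - y.1) + t ^ (1 / k) * y.2)
      = - (B * (x.1 - y.1)) + t ^ (1 / k) * (x.2 - y.2) := by ring
    rw [e]
    refine (abs_add_le _ _).trans ?_
    rw [abs_neg, abs_mul, abs_mul, abs_of_pos hB, abs_of_nonneg s0, add_mul]
    gcongr
  set C : ℝ := (1 + |A|) / k with hC
  have hCpos : 0 < C := by positivity
  have hc : ∀ t ∈ Icc (0:ℝ) 1, |t ^ (1 / k) / k| ≤ C ∧ |A / k| ≤ C := by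
    intro t ht
    obtain ⟨s0, s1⟩ := hs1 t ht
    rw [abs_div, abs_div, abs_of_pos hk, abs_of_nonneg s0]
    constructor
    · rw [hC]; gcongr; linarith [abs_nonneg A]
    · rw [hC]; gcongr; linarith
  set L : ℝ := C * (2 / B) with hL
  have hLpos : 0 < L := by positivity
  set ε : ℝ := min 1 (1 / L) with hε
  have hεpos : 0 < ε := by positivity
  have hsub : Icc 0 ε ⊆ Icc (0:ℝ) 1 := Icc_subset_Icc_right (min_le_left _ _)
  have hPL : IsPicardLindelof F (tmin := 0) (tmax := ε) ⟨0, le_refl _, hεpos.le⟩ (0 : ℝ × ℝ) 1 0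
      ⟨L, hLpos.le⟩ ⟨C * (4 / B ^ 2 * (B + 1)), by positivity⟩ := by
    refine ⟨?_, ?_, ?_, ?_⟩
    · intro t ht
      refine LipschitzOnWith.of_dist_le_mul ?_
      intro x _ y _
      have hl := hGlip t (hsub ht) x y
      obtain ⟨c1, c2⟩ := hc t (hsub ht)
      show max (|_ - _|) (|_ - _|) ≤ C * (4 / B ^ 2 * (B + 1)) * dist x y
      simp only [hF]
      rw [← mul_sub, ← mul_sub, abs_mul, abs_mul, mul_assoc]
      refine max_le ?_ ?_ <;> gcongr
    · intro x _
      refine Continuous.continuousOn ?_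
      have : Continuous (fun t => G t x) := by
        refine Continuous.inv₀ (by fun_prop) (fun t => (hmpos _).ne')
      simp only [hF]
      fun_prop
    · intro t ht x _
      obtain ⟨c1, c2⟩ := hc t (hsub ht)
      show max (|_|) (|_|) ≤ C * (2 / B)
      simp only [hF]
      rw [abs_mul, abs_mul, abs_of_nonneg (hG0 t x)]
      have := hGle t x
      have := hG0 t x
      refine max_le ?_ ?_ <;> gcongr
    · show L * max (ε - 0) (0 - 0) ≤ 1 - 0
      rw [sub_zero, sub_zero, max_eq_left hεpos.le, sub_zero]
      calc L * ε ≤ L * (1 / L) := by gcongr; exact min_le_right _ _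
        _ = 1 := by field_simp
  obtain ⟨f, hf0, hf⟩ := hPL.exists_eq_forall_mem_Icc_hasDerivWithinAt₀
  have hf0 : f 0 = 0 := hf0
  have hfc : ContinuousOn f (Icc 0 ε) := fun t ht => (hf t ht).continuousWithinAt
  set Y : ℝ → ℝ := fun t => (f t).1 with hY
  set r : ℝ → ℝ := fun t => (f t).2 with hr
  have hYc : ContinuousOn Y (Icc 0 ε) := continuous_fst.comp_continuousOn hfc
  have hrc : ContinuousOn r (Icc 0 ε) := continuous_snd.comp_continuousOn hfc
  have hY0 : Y 0 = 0 := by simp [hY, hf0]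
  have hr0 : r 0 = 0 := by simp [hr, hf0]
  have hpc : ContinuousOn (fun t => B * (1 - Y t) + t ^ (1 / k) * r t) (Icc 0 ε) := by
    have := hs.continuousOn (s := Icc 0 ε)
    fun_prop
  have m0 : (0:ℝ) ∈ Icc 0 ε := ⟨le_refl _, hεpos.le⟩
  have ev1 : ∀ᶠ t in 𝓝[Icc 0 ε] 0, B / 2 < B * (1 - Y t) + t ^ (1 / k) * r t := by
    refine (hpc 0 m0).eventually (lt_mem_nhds ?_)
    simp only [hY0, hr0]; linarith
  have ev2 : ∀ᶠ t in 𝓝[Icc 0 ε] 0, Y t < 1 :=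
    (hYc 0 m0).eventually (gt_mem_nhds (by rw [hY0]; norm_num))
  obtain ⟨δ, hδ, hδs⟩ := Metric.mem_nhdsWithin_iff.1 (ev1.and ev2)
  set η := min ε (δ / 2) with hη
  have hηpos : 0 < η := by positivity
  have hηε : η ≤ ε := min_le_left _ _
  have hsubη : Icc 0 η ⊆ Icc 0 ε := Icc_subset_Icc_right hηε
  have key : ∀ t ∈ Icc 0 η, B / 2 < B * (1 - Y t) + t ^ (1 / k) * r t ∧ Y t < 1 := by
    intro t ht
    refine hδs ⟨?_, hsubη ht⟩
    rw [Metric.mem_ball, Real.dist_eq, sub_zero, abs_of_nonneg ht.1]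
    have : η ≤ δ / 2 := min_le_right _ _
    linarith [ht.2]
  have hFd : ∀ t ∈ Ioo 0 η, HasDerivAt f (F t (f t)) t := fun t ht =>
    (hf t (hsubη (Ioo_subset_Icc_self ht))).hasDerivAt (Icc_mem_nhds ht.1 (ht.2.trans_le hηε))
  have hGe : ∀ t ∈ Ioo 0 η, G t (f t) = (B * (1 - Y t) + t ^ (1 / k) * r t)⁻¹ := by
    intro t ht
    simp only [hG]
    rw [max_eq_right]
    exact (key t (Ioo_subset_Icc_self ht)).1.le
  refine ⟨η, hηpos, Y, r, hY0, hr0, hYc.mono hsubη, hrc.mono hsubη, (key η ⟨hηpos.le, le_refl _⟩).2,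
    fun t ht => by linarith [(key t ht).1], ?_, ?_⟩
  · intro t ht
    have h := (hasFDerivAt_fst (𝕜 := ℝ) (p := f t)).comp_hasDerivAt t (hFd t ht)
    refine h.congr_deriv ?_
    show t ^ (1 / k) / k * G t (f t) = _
    rw [hGe t ht, ← div_eq_mul_inv, div_div]
  · intro t ht
    have h := (hasFDerivAt_snd (𝕜 := ℝ) (p := f t)).comp_hasDerivAt t (hFd t ht)
    refine h.congr_deriv ?_
    show A / k * G t (f t) = _
    rw [hGe t ht, ← div_eq_mul_inv, div_div]

lemma inv_core (ε : ℝ) (hε : 0 < ε) (Y dY : ℝ → ℝ) (hY0 : Y 0 = 0)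
    (hc : ContinuousOn Y (Icc 0 ε)) (hd : ∀ t ∈ Ioo 0 ε, HasDerivAt Y (dY t) t)
    (hpos : ∀ t ∈ Ioo 0 ε, 0 < dY t) :
    0 < Y ε ∧ ∃ T : ℝ → ℝ, (∀ y ∈ Ioo 0 (Y ε), T y ∈ Ioo 0 ε ∧ Y (T y) = y ∧
      HasDerivAt T (dY (T y))⁻¹ y) ∧ Tendsto T (𝓝[>] 0) (𝓝[>] 0) := by
  have hm : StrictMonoOn Y (Icc 0 ε) := by
    refine strictMonoOn_of_deriv_pos (convex_Icc _ _) hc ?_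
    intro t ht
    rw [interior_Icc] at ht
    rw [(hd t ht).deriv]
    exact hpos t ht
  have m0 : (0:ℝ) ∈ Icc 0 ε := ⟨le_refl _, hε.le⟩
  have m1 : ε ∈ Icc 0 ε := ⟨hε.le, le_refl _⟩
  have hYε : 0 < Y ε := by
    have := hm m0 m1 hε
    rwa [hY0] at this
  have hex : ∀ y ∈ Ioo 0 (Y ε), ∃ t ∈ Ioo 0 ε, Y t = y := by
    intro y hy
    have := intermediate_value_Ioo hε.le hc
    rw [hY0] at this
    exact this hy
  choose! T hT hYT using hex
  have hYm : ∀ t ∈ Ioo 0 ε, Y t ∈ Ioo 0 (Y ε) := by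
    intro t ht
    have h1 := hm m0 (Ioo_subset_Icc_self ht) ht.1
    have h2 := hm (Ioo_subset_Icc_self ht) m1 ht.2
    rw [hY0] at h1
    exact ⟨h1, h2⟩
  have hTY : ∀ t ∈ Ioo 0 ε, T (Y t) = t := by
    intro t ht
    exact hm.injOn (Ioo_subset_Icc_self (hT _ (hYm t ht))) (Ioo_subset_Icc_self ht)
      (hYT _ (hYm t ht))
  have hTm : StrictMonoOn T (Ioo 0 (Y ε)) := by
    intro x hx y hy hxy
    rw [← hm.lt_iff_lt (Ioo_subset_Icc_self (hT _ hx)) (Ioo_subset_Icc_self (hT _ hy)),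
      hYT x hx, hYT y hy]
    exact hxy
  refine ⟨hYε, T, ?_, ?_⟩
  · intro y hy
    refine ⟨hT y hy, hYT y hy, ?_⟩
    have hcont : ContinuousAt T y := by
      refine hTm.continuousAt_of_image_mem_nhds (Ioo_mem_nhds hy.1 hy.2) ?_
      refine mem_of_superset (Ioo_mem_nhds (hT y hy).1 (hT y hy).2) ?_
      intro t ht
      exact ⟨Y t, hYm t ht, hTY t ht⟩
    refine HasDerivAt.of_local_left_inverse hcont (hd _ (hT y hy)) (hpos _ (hT y hy)).ne' ?_
    filter_upwards [Ioo_mem_nhds hy.1 hy.2] with z hz using hYT z hz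
  · have hev : ∀ᶠ y in 𝓝[>] (0:ℝ), y ∈ Ioo 0 (Y ε) := Ioo_mem_nhdsGT hYε
    refine tendsto_nhdsWithin_iff.2 ⟨?_, hev.mono fun y hy => (hT y hy).1⟩
    rw [tendsto_order]
    constructor
    · intro c hc0
      exact hev.mono fun y hy => hc0.trans (hT y hy).1
    · intro c hc0
      have hd : min c (ε / 2) ∈ Ioo 0 ε :=
        ⟨by positivity, (min_le_right _ _).trans_lt (by linarith)⟩
      filter_upwards [hev, Ioo_mem_nhdsGT (hYm _ hd).1] with y hy hy2
      refine lt_of_lt_of_le ?_ (min_le_left c (ε / 2))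
      rw [← hm.lt_iff_lt (Ioo_subset_Icc_self (hT _ hy)) (Ioo_subset_Icc_self hd), hYT y hy]
      exact hy2.2

theorem selfsimilar_blowup_exists (m a b : ℝ) (hm : m < 0) (hb : b < 0) :
    ∃ χ₀ χmax : ℝ, 0 < χ₀ ∧ χ₀ < χmax ∧
      ∃ c_u c_v : ℝ, 0 < c_u ∧ 0 < c_v ∧
      ∃ u du : ℝ → ℝ,
        (∀ χ ∈ Ico χ₀ χmax, 0 < u χ) ∧
        (∀ χ ∈ Ico χ₀ χmax, HasDerivWithinAt u (du χ) (Ico χ₀ χmax) χ) ∧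
        (∀ χ ∈ Ico χ₀ χmax,
          HasDerivWithinAt (fun σ => u σ ^ (m - 1) * du σ)
            (-(b * χ * du χ) - a * u χ) (Ico χ₀ χmax) χ) ∧
        Tendsto (fun χ => u χ * (χmax - χ) ^ (1 / (1 - m)))
          (𝓝[<] χmax) (𝓝 c_u) ∧
        Tendsto (fun χ => u χ ^ (m - 1) * du χ * (χmax - χ) ^ (1 / (1 - m)))
          (𝓝[<] χmax) (𝓝 c_v) := by
  obtain ⟨k, rfl⟩ : ∃ k, m = -k := ⟨-m, by ring⟩
  obtain ⟨B, rfl⟩ : ∃ B, b = -B := ⟨-b, by ring⟩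
  have hk : 0 < k := by linarith
  have hB : 0 < B := by linarith
  obtain ⟨ε, hε, Y, r, hY0, hr0, hYc, hrc, hY1, hp, hdY, hdr⟩ := ode_core B k (a + B) hB hk
  set p : ℝ → ℝ := fun t => B * (1 - Y t) + t ^ (1 / k) * r t with hpdef
  have hspos : ∀ t ∈ Ioo 0 ε, 0 < t ^ (1 / k) := fun t ht => Real.rpow_pos_of_pos ht.1 _
  have hppos : ∀ t ∈ Ioo 0 ε, 0 < p t := fun t ht => hp t (Ioo_subset_Icc_self ht)
  obtain ⟨hYε, T, hT, hTlim⟩ := inv_core ε hε Y (fun t => t ^ (1 / k) / (k * p t)) hY0 hYc hdY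
    (fun t ht => div_pos (hspos t ht) (mul_pos hk (hppos t ht)))
  have h1k : 0 < 1 / k := by positivity
  have hpc : ContinuousOn p (Icc 0 ε) := by
    have := (Real.continuous_rpow_const h1k.le).continuousOn (s := Icc 0 ε)
    fun_prop
  have hnhds : 𝓝[>] (0:ℝ) ≤ 𝓝[Icc 0 ε] 0 := by
    rw [← nhdsWithin_Ioo_eq_nhdsGT hε]
    exact nhdsWithin_mono _ Ioo_subset_Icc_self
  have m0 : (0:ℝ) ∈ Icc 0 ε := ⟨le_refl _, hε.le⟩
  have hplim : Tendsto p (𝓝[>] 0) (𝓝 B) := by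
    have h := (hpc 0 m0).tendsto.mono_left hnhds
    have e : p 0 = B := by simp [hpdef, hY0, hr0]
    rwa [e] at h
  have hYlim : Tendsto Y (𝓝[>] 0) (𝓝 0) := by
    have h := (hYc 0 m0).tendsto.mono_left hnhds
    rwa [hY0] at h
  have hratio : Tendsto (fun t => Y t / t ^ (1 / k + 1)) (𝓝[>] 0) (𝓝 (1 / ((k + 1) * B))) := by
    refine HasDerivAt.lhopital_zero_right_on_Ioo hε hdY
      (g' := fun t => (1 / k + 1) * t ^ (1 / k)) ?_ ?_ hYlim ?_ ?_
    · intro t ht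
      have := Real.hasDerivAt_rpow_const (x := t) (p := 1 / k + 1) (Or.inl ht.1.ne')
      simpa using this
    · intro t ht
      have := hspos t ht
      positivity
    · have h := (Real.continuous_rpow_const (q := 1 / k + 1) (by positivity)).tendsto (0:ℝ)
      rw [Real.zero_rpow (by positivity)] at h
      exact h.mono_left nhdsWithin_le_nhds
    · have h : Tendsto (fun t => 1 / ((k + 1) * p t)) (𝓝[>] 0) (𝓝 (1 / ((k + 1) * B))) :=
        tendsto_const_nhds.div (hplim.const_mul _) (by positivity)
      refine h.congr' ?_
      filter_upwards [Ioo_mem_nhdsGT hε] with t ht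
      have h1 := hspos t ht
      have h2 := hppos t ht
      show _ = t ^ (1 / k) / (k * p t) / ((1 / k + 1) * t ^ (1 / k))
      field_simp
      ring
  set u : ℝ → ℝ := fun χ => (T (1 - χ)) ^ (-(1 / k)) with hu
  set du : ℝ → ℝ := fun χ => p (T (1 - χ)) * u χ ^ (k + 2) with hdu
  have hmem : ∀ χ ∈ Ioo (1 - Y ε) 1, 1 - χ ∈ Ioo 0 (Y ε) := fun χ h =>
    ⟨by linarith [h.2], by linarith [h.1]⟩
  have hupos : ∀ χ ∈ Ioo (1 - Y ε) 1, 0 < u χ := fun χ h =>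
    Real.rpow_pos_of_pos (hT _ (hmem χ h)).1.1 _
  have hv : ∀ χ ∈ Ioo (1 - Y ε) 1, u χ ^ (-k - 1) * du χ = p (T (1 - χ)) * u χ := by
    intro χ h
    have h0 := hupos χ h
    have : u χ ^ (-k - 1) * u χ ^ (k + 2) = u χ := by
      rw [← Real.rpow_add h0]
      rw [show -k - 1 + (k + 2) = 1 by ring, Real.rpow_one]
    calc _ = p (T (1 - χ)) * (u χ ^ (-k - 1) * u χ ^ (k + 2)) := by simp only [hdu]; ring
      _ = _ := by rw [this]
  have hv2 : ∀ χ ∈ Ioo (1 - Y ε) 1, u χ ^ (-k - 1) * du χ = B * χ * u χ + r (T (1 - χ)) := by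
    intro χ h
    rw [hv χ h]
    obtain ⟨h1, h2, -⟩ := hT _ (hmem χ h)
    simp only [hpdef, hu, h2]
    have hs := hspos _ h1
    rw [Real.rpow_neg h1.1.le]
    field_simp
    ring
  have hTd : ∀ χ ∈ Ioo (1 - Y ε) 1, HasDerivAt (fun σ => T (1 - σ))
      (-(k * p (T (1 - χ)) * u χ)) χ := by
    intro χ h
    obtain ⟨h1, h2, h3⟩ := hT _ (hmem χ h)
    have h4 := h3.comp_const_sub 1 χ
    refine h4.congr_deriv ?_
    simp only [hu]
    rw [Real.rpow_neg h1.1.le, inv_div, div_eq_mul_inv]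
  have hud : ∀ χ ∈ Ioo (1 - Y ε) 1, HasDerivAt u (du χ) χ := by
    intro χ h
    obtain ⟨h1, h2, h3⟩ := hT _ (hmem χ h)
    have h4 := (hTd χ h).rpow_const (p := -(1 / k)) (Or.inl h1.1.ne')
    refine h4.congr_deriv ?_
    have e1 : u χ ^ (k + 2) = u χ * T (1 - χ) ^ (-(1 / k) - 1) := by
      simp only [hu]
      rw [← Real.rpow_mul h1.1.le, ← Real.rpow_add h1.1]
      congr 1
      field_simp
      ring
    simp only [hdu]
    rw [e1]
    field_simp
  have hsub : ∀ χ ∈ Ico (1 - Y ε / 2) 1, χ ∈ Ioo (1 - Y ε) 1 := fun χ h =>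
    ⟨by linarith [h.1], h.2⟩
  have hflip : Tendsto (fun χ : ℝ => 1 - χ) (𝓝[<] 1) (𝓝[>] 0) := by
    refine tendsto_nhdsWithin_iff.2 ⟨?_, ?_⟩
    · have : Tendsto (fun χ : ℝ => 1 - χ) (𝓝 1) (𝓝 (1 - 1)) := by
        exact (continuous_const.sub continuous_id).tendsto 1
      rw [sub_self] at this
      exact this.mono_left nhdsWithin_le_nhds
    · filter_upwards [self_mem_nhdsWithin] with χ hχ
      simpa using hχ
  have hTT : Tendsto (fun χ => T (1 - χ)) (𝓝[<] 1) (𝓝[>] 0) := hTlim.comp hflip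
  have hev : ∀ᶠ χ in 𝓝[<] (1:ℝ), χ ∈ Ioo (1 - Y ε) 1 := Ioo_mem_nhdsLT (by linarith)
  have hulim : Tendsto (fun χ => u χ * (1 - χ) ^ (1 / (1 - -k))) (𝓝[<] 1)
      (𝓝 ((1 / ((k + 1) * B)) ^ (1 / (k + 1)))) := by
    have h := (hratio.comp hTT).rpow_const (p := 1 / (k + 1)) (Or.inr (by positivity))
    refine h.congr' ?_
    filter_upwards [hev] with χ hχ
    obtain ⟨h1, h2, -⟩ := hT _ (hmem χ hχ)
    simp only [Function.comp, h2, hu]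
    rw [Real.div_rpow (hmem χ hχ).1.le (Real.rpow_nonneg h1.1.le _), ← Real.rpow_mul h1.1.le,
      show (1 / k + 1) * (1 / (k + 1)) = 1 / k by field_simp; ring, Real.rpow_neg h1.1.le,
      show 1 - -k = k + 1 by ring, div_eq_mul_inv, mul_comm]
  refine ⟨1 - Y ε / 2, 1, by linarith, by linarith, (1 / ((k + 1) * B)) ^ (1 / (k + 1)),
    B * (1 / ((k + 1) * B)) ^ (1 / (k + 1)), by positivity, by positivity, u, du,
    fun χ h => hupos χ (hsub χ h), fun χ h => (hud χ (hsub χ h)).hasDerivWithinAt, ?_, hulim, ?_⟩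
  · intro χ h
    have h := hsub χ h
    obtain ⟨h1, h2, -⟩ := hT _ (hmem χ h)
    have hpp := hppos _ h1
    refine HasDerivAt.hasDerivWithinAt ?_
    have d1 := ((hasDerivAt_id χ).const_mul B).mul (hud χ h)
    have d2 := (hdr _ h1).comp χ (hTd χ h)
    refine ((d1.add d2).congr_of_eventuallyEq ?_).congr_deriv ?_
    · filter_upwards [Ioo_mem_nhds h.1 h.2] with σ hσ using hv2 σ hσ
    · change B * 1 * u χ + B * χ * du χ +
        (a + B) / (k * p (T (1 - χ))) * -(k * p (T (1 - χ)) * u χ) = _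
      field_simp
      ring
  · refine ((hplim.comp hTT).mul hulim).congr' ?_
    filter_upwards [hev] with χ hχ
    rw [hv χ hχ, Function.comp, mul_assoc]
end

section
/- Let n ∈ ℕ, q ∈ ℝ, and let p ≥ 2 be an even natural number. Then there exist 0 < r₀ < r_max < ∞, constants c_u, c̃_u > 0, and a twice continuously differentiable negative function u : [r₀, r_max) → (−∞, 0) satisfying u''(r) + ((n−1)/r)·u'(r) − r^q·u(r)^{−p} = 0 for all r ∈ [r₀, r_max), such that u(r)·(r_max − r)^{−2/(p+1)} → −c_u and u'(r)·(r_max − r)^{(p−1)/(p+1)} → c̃_u as r → r_max⁻. In particular u(r) → 0 while u'(r) → +∞ as r → r_max⁻, i.e. u is a quenching solution of the MEMS-like radial stationary equation. -/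
open Real Set Filter Topology

theorem mems_glob {E : Type*} [NormedAddCommGroup E] [NormedSpace ℝ E] [CompleteSpace E]
    (F : ℝ → E → E) (hc : ∀ x, Continuous (fun t => F t x))
    (hF : ∀ N : ℕ, ∃ K L : NNReal, ∀ t ∈ Icc (-(N:ℝ)) N, LipschitzWith K (F t) ∧ ∀ x, ‖F t x‖ ≤ L)
    (x0 : E) : ∃ α : ℝ → E, α 0 = x0 ∧ ∀ t, HasDerivAt α (F t (α t)) t := by
  have loc : ∀ N : ℕ, ∃ α : ℝ → E, α 0 = x0 ∧ ∀ t ∈ Ioo (-(N:ℝ)) N, HasDerivAt α (F t (α t)) t := by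
    intro N
    obtain ⟨K, L, h⟩ := hF N
    have hP : IsPicardLindelof F (tmin := -(N:ℝ)) (tmax := N) ⟨0, by simp⟩ x0 (L * N) 0 L K :=
      { lipschitzOnWith := fun t ht => (h t ht).1.lipschitzOnWith
        continuousOn := fun x _ => (hc x).continuousOn
        norm_le := fun t ht x _ => (h t ht).2 x
        mul_max_le := by simp }
    obtain ⟨α, h0, h1⟩ := hP.exists_eq_forall_mem_Icc_hasDerivWithinAt₀
    exact ⟨α, h0, fun t ht => (h1 t ⟨ht.1.le, ht.2.le⟩).hasDerivAt (Icc_mem_nhds ht.1 ht.2)⟩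
  choose β h0 h1 using loc
  have uniq : ∀ N M : ℕ, N ≤ M → EqOn (β N) (β M) (Ioo (-(N:ℝ)) N) := by
    intro N M hNM
    obtain ⟨K, L, h⟩ := hF N
    rcases Nat.eq_zero_or_pos N with rfl | hN
    · intro t ht; simp at ht
    have hN' : (0:ℝ) < N := by exact_mod_cast hN
    have hNM' : (N:ℝ) ≤ M := by exact_mod_cast hNM
    refine ODE_solution_unique_of_mem_Ioo (v := F) (s := fun _ => univ) (K := K) (t₀ := 0)
      (fun t ht => ((h t ⟨ht.1.le, ht.2.le⟩).1.lipschitzOnWith)) ⟨by linarith, hN'⟩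
      (fun t ht => ⟨h1 N t ht, trivial⟩) (fun t ht => ⟨h1 M t ⟨by linarith [ht.1], by linarith [ht.2]⟩, trivial⟩)
      (by rw [h0, h0])
  refine ⟨fun t => β (⌈|t|⌉₊ + 1) t, by simp [h0], fun t => ?_⟩
  have key : ∀ M : ℕ, ∀ s : ℝ, |s| < M → β (⌈|s|⌉₊ + 1) s = β M s := by
    intro M s hs
    have h2 : |s| < ((⌈|s|⌉₊ + 1 : ℕ):ℝ) := by
      push_cast; linarith [Nat.le_ceil |s|]
    rcases le_total (⌈|s|⌉₊ + 1) M with hh | hh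
    · exact uniq _ _ hh (abs_lt.1 h2)
    · exact (uniq _ _ hh (abs_lt.1 hs)).symm
  obtain ⟨M, hM⟩ := exists_nat_gt |t|
  have := h1 M t (abs_lt.1 hM)
  simp only
  rw [key M t hM]
  refine this.congr_of_eventuallyEq ?_
  have : ∀ᶠ s : ℝ in 𝓝 t, |s| < (M:ℝ) := (continuous_abs.continuousAt).eventually_lt continuousAt_const hM
  filter_upwards [this] with s hs using key M s hs

theorem mems_clamp (a : ℝ) : ∃ K : NNReal, LipschitzWith K (fun x : ℝ => (max 1 (min x 2)) ^ a) := by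
  have hcont : ContinuousOn (fun x : ℝ => a * x ^ (a - 1)) (Icc 1 2) := by
    apply ContinuousOn.mul continuousOn_const
    apply ContinuousOn.rpow_const continuousOn_id
    intro x hx; left; exact (lt_of_lt_of_le one_pos hx.1).ne'
  obtain ⟨C, hC⟩ := isCompact_Icc.exists_bound_of_continuousOn hcont
  have h1 : LipschitzOnWith C.toNNReal (fun x : ℝ => x ^ a) (Icc 1 2) := by
    apply (convex_Icc (1:ℝ) 2).lipschitzOnWith_of_nnnorm_hasDerivWithin_le
      (f' := fun x => a * x ^ (a - 1))
    · intro x hx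
      exact (Real.hasDerivAt_rpow_const (Or.inl (lt_of_lt_of_le one_pos hx.1).ne')).hasDerivWithinAt
    · intro x hx
      rw [← NNReal.coe_le_coe]
      exact (hC x hx).trans (Real.le_coe_toNNReal C)
  refine ⟨C.toNNReal, ?_⟩
  have h2 : LipschitzWith 1 (fun x : ℝ => max 1 (min x 2)) :=
    (LipschitzWith.id.min_const 2).const_max 1
  have := h1.comp (h2.lipschitzOnWith (s := univ)) (fun x _ => ⟨le_max_left _ _, max_le (by norm_num) (min_le_right _ _)⟩)
  rw [mul_one, lipschitzOnWith_univ] at this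
  exact this

theorem mems_pow_le (a x : ℝ) (h1 : 1 ≤ x) (h2 : x ≤ 2) : x ^ a ≤ 2 ^ |a| :=
  (rpow_le_rpow_of_exponent_le h1 (le_abs_self a)).trans
    (rpow_le_rpow (by linarith) h2 (abs_nonneg a))

noncomputable def memsG (a m0 : ℝ) (x : ℝ × ℝ) : ℝ := (max 1 (min x.1 2)) ^ a * (max m0 x.2)⁻¹

theorem memsG_lip (a m0 : ℝ) (hm : 1 ≤ m0) : ∃ K : NNReal, LipschitzWith K (memsG a m0) ∧
    ∀ x, |memsG a m0 x| ≤ K := by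
  obtain ⟨K, hK⟩ := mems_clamp a
  have hb : ∀ x : ℝ, 0 < (max 1 (min x 2)) ^ a ∧ (max 1 (min x 2)) ^ a ≤ 2 ^ |a| := fun x =>
    ⟨rpow_pos_of_pos (lt_of_lt_of_le one_pos (le_max_left _ _)) _, mems_pow_le _ _ (le_max_left _ _) (max_le (by norm_num) (min_le_right _ _))⟩
  have hi : ∀ x : ℝ, 0 < (max m0 x)⁻¹ ∧ (max m0 x)⁻¹ ≤ 1 := fun x =>
    ⟨inv_pos.2 (by linarith [le_max_left m0 x]), inv_le_one_of_one_le₀ (by linarith [le_max_left m0 x])⟩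
  have hil : ∀ x y : ℝ, |(max m0 x)⁻¹ - (max m0 y)⁻¹| ≤ |x - y| := by
    intro x y
    have e : (max m0 x)⁻¹ - (max m0 y)⁻¹ = (max m0 x)⁻¹ * (max m0 y)⁻¹ * (max m0 y - max m0 x) := by
      have := (inv_pos.1 (hi x).1).ne'
      have := (inv_pos.1 (hi y).1).ne'
      field_simp
    rw [e, abs_mul, abs_of_pos (mul_pos (hi x).1 (hi y).1)]
    have h1 : (max m0 x)⁻¹ * (max m0 y)⁻¹ ≤ 1 := mul_le_one₀ (hi x).2 (hi y).1.le (hi y).2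
    have h2 : |max m0 y - max m0 x| ≤ |x - y| := by
      have := (LipschitzWith.id (α := ℝ)).const_max m0 |>.dist_le_mul x y
      simpa [Real.dist_eq, abs_sub_comm] using this
    calc _ ≤ 1 * |max m0 y - max m0 x| := by gcongr
      _ ≤ _ := by linarith
  have hC : (0:ℝ) < 2 ^ |a| := by positivity
  refine ⟨K + (2 ^ |a| : ℝ).toNNReal, LipschitzWith.of_dist_le_mul ?_, ?_⟩
  · intro x y
    have d1 : |x.1 - y.1| ≤ dist x y := by
      rw [← Real.dist_eq, Prod.dist_eq]; exact le_max_left _ _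
    have d2 : |x.2 - y.2| ≤ dist x y := by
      rw [← Real.dist_eq, Prod.dist_eq]; exact le_max_right _ _
    have h1 := hK.dist_le_mul x.1 y.1
    rw [Real.dist_eq, Real.dist_eq] at h1
    have h2 := hil x.2 y.2
    rw [Real.dist_eq, NNReal.coe_add, Real.coe_toNNReal _ hC.le]
    unfold memsG
    set P := (max 1 (min x.1 2)) ^ a
    set Q := (max 1 (min y.1 2)) ^ a
    set S := (max m0 x.2)⁻¹
    set T := (max m0 y.2)⁻¹
    have e : P * S - Q * T = (P - Q) * S + Q * (S - T) := by ring
    rw [e]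
    refine (abs_add_le _ _).trans ?_
    rw [abs_mul, abs_mul, abs_of_pos (hi x.2).1, abs_of_pos (hb y.1).1, add_mul]
    apply add_le_add
    · calc |P - Q| * S ≤ |P - Q| * 1 := by gcongr; exact (hi x.2).2
        _ ≤ K * |x.1 - y.1| := by simpa using h1
        _ ≤ _ := by gcongr
    · calc Q * |S - T| ≤ 2 ^ |a| * |x.2 - y.2| := by gcongr; exact (hb y.1).2
        _ ≤ _ := by gcongr
  · intro x
    unfold memsG
    rw [abs_of_pos (mul_pos (hb _).1 (hi _).1), NNReal.coe_add, Real.coe_toNNReal _ hC.le]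
    have := mul_le_mul (hb x.1).2 (hi x.2).2 (hi _).1.le hC.le
    have := K.2
    simp only [NNReal.val_eq_coe] at this
    linarith

theorem mems_core (a b k : ℝ) : ∃ R m : ℝ → ℝ, R 0 = 1 ∧
    (∀ t, ∃ R' : ℝ, 0 < R' ∧ HasDerivAt R R' t) ∧
    ∀ t, 0 ≤ t → 0 < m t ∧ R t ≤ 2 ∧ HasDerivAt R (R t ^ a * (m t)⁻¹ * exp (-t)) t ∧
      HasDerivAt m (R t ^ b * (m t)⁻¹ * exp (k * t)) t := by
  set m0 : ℝ := 2 ^ |a| with hm0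
  have hm : 1 ≤ m0 := one_le_rpow (by norm_num) (abs_nonneg a)
  obtain ⟨K1, l1, b1⟩ := memsG_lip a m0 hm
  obtain ⟨K2, l2, b2⟩ := memsG_lip b m0 hm
  have pos : ∀ c x, 0 < memsG c m0 x := fun c x => mul_pos
    (rpow_pos_of_pos (lt_of_lt_of_le one_pos (le_max_left _ _)) _)
    (inv_pos.2 (by linarith [le_max_left m0 x.2]))
  obtain ⟨α, h0, h1⟩ := mems_glob (E := ℝ × ℝ)
    (fun t x => (exp (-t) * memsG a m0 x, exp (k * t) * memsG b m0 x))
    (by intro x; fun_prop)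
    (by
      intro N
      set B : NNReal := (exp ((1 + |k|) * N)).toNNReal with hB
      have hBc : (B : ℝ) = exp ((1 + |k|) * N) := Real.coe_toNNReal _ (exp_pos _).le
      have e1 : ∀ t ∈ Icc (-(N:ℝ)) N, exp (-t) ≤ B ∧ exp (k * t) ≤ B := by
        intro t ht
        have hN : |t| ≤ N := abs_le.2 ht
        have h3 : k * t ≤ |k| * N := (le_abs_self _).trans (by rw [abs_mul]; gcongr)
        have h4 : 0 ≤ |k| * (N:ℝ) := by positivity
        have h5 : (0:ℝ) ≤ N := by positivity
        rw [hBc]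
        exact ⟨exp_le_exp.2 (by linarith [ht.1]), exp_le_exp.2 (by linarith)⟩
      refine ⟨B * (K1 + K2), B * (K1 + K2), fun t ht => ⟨?_, ?_⟩⟩
      · apply LipschitzWith.of_dist_le_mul
        intro x y
        rw [Prod.dist_eq, Real.dist_eq, Real.dist_eq, ← mul_sub, ← mul_sub, abs_mul, abs_mul,
          abs_of_pos (exp_pos _), abs_of_pos (exp_pos _)]
        have q1 := l1.dist_le_mul x y
        have q2 := l2.dist_le_mul x y
        rw [Real.dist_eq] at q1 q2
        push_cast
        rw [mul_assoc]
        have d := dist_nonneg (x := x) (y := y)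
        have := mul_nonneg K1.2 d
        have := mul_nonneg K2.2 d
        simp only [NNReal.val_eq_coe] at *
        apply max_le
        · exact mul_le_mul (e1 t ht).1 (by linarith) (abs_nonneg _) B.2
        · exact mul_le_mul (e1 t ht).2 (by linarith) (abs_nonneg _) B.2
      · intro x
        rw [Prod.norm_def, Real.norm_eq_abs, Real.norm_eq_abs, abs_mul, abs_mul,
          abs_of_pos (exp_pos _), abs_of_pos (exp_pos _)]
        push_cast
        have q1 := b1 x
        have q2 := b2 x
        have := K1.2
        have := K2.2
        simp only [NNReal.val_eq_coe] at *
        apply max_le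
        · exact mul_le_mul (e1 t ht).1 (by linarith) (abs_nonneg _) B.2
        · exact mul_le_mul (e1 t ht).2 (by linarith) (abs_nonneg _) B.2)
    (1, m0)
  have hR : ∀ t, HasDerivAt (fun t => (α t).1) (exp (-t) * memsG a m0 (α t)) t := fun t => (h1 t).fst
  have hM : ∀ t, HasDerivAt (fun t => (α t).2) (exp (k * t) * memsG b m0 (α t)) t := fun t => (h1 t).snd
  have mR : StrictMono (fun t => (α t).1) := strictMono_of_hasDerivAt_pos hR
    (fun t => mul_pos (exp_pos _) (pos _ _))
  have mM : StrictMono (fun t => (α t).2) := strictMono_of_hasDerivAt_pos hM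
    (fun t => mul_pos (exp_pos _) (pos _ _))
  have gle : ∀ x, memsG a m0 x ≤ 1 := by
    intro x
    unfold memsG
    rw [← div_eq_mul_inv, div_le_one (by linarith [le_max_left m0 x.2])]
    exact (mems_pow_le _ _ (le_max_left _ _) (max_le (by norm_num) (min_le_right _ _))).trans (le_max_left _ _)
  have anti : Antitone (fun t => (α t).1 + exp (-t)) := by
    apply antitone_of_hasDerivAt_nonpos (f' := fun t => exp (-t) * memsG a m0 (α t) + exp (-t) * (-1))
    · intro t
      exact (hR t).add ((hasDerivAt_neg t).exp)
    · intro t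
      simp only [Pi.zero_apply]
      have := mul_le_mul_of_nonneg_left (gle (α t)) (exp_pos (-t)).le
      linarith
  refine ⟨fun t => (α t).1, fun t => (α t).2, by simp [h0], fun t => ⟨_, mul_pos (exp_pos _) (pos _ _), hR t⟩, ?_⟩
  intro t ht
  have r1 : 1 ≤ (α t).1 := by simpa [h0] using mR.monotone ht
  have r2 : m0 ≤ (α t).2 := by simpa [h0] using mM.monotone ht
  have r3 : (α t).1 ≤ 2 := by
    have := anti ht
    simp only [h0, neg_zero, exp_zero] at this
    linarith [exp_pos (-t)]
  have ge : ∀ c, memsG c m0 (α t) = (α t).1 ^ c * ((α t).2)⁻¹ := by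
    intro c; unfold memsG
    rw [min_eq_left r3, max_eq_right r1, max_eq_right r2]
  refine ⟨by linarith, r3, ?_, ?_⟩
  · simp only; rw [← ge, mul_comm]; exact hR t
  · simp only; rw [← ge, mul_comm]; exact hM t

theorem mems_upper (f h : ℝ → ℝ) (k L : ℝ) (hk : 0 < k)
    (hf : ∀ t, 0 ≤ t → HasDerivAt f (h t * exp (k * t)) t)
    (hh : Tendsto h atTop (𝓝 L)) (ε : ℝ) (hε : 0 < ε) :
    ∀ᶠ t in atTop, f t * exp (-(k * t)) < L / k + ε := by
  set c := L + k * ε / 2 with hc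
  have h1 : ∀ᶠ t in atTop, h t < c := hh.eventually_lt_const (by have := mul_pos hk hε; linarith)
  obtain ⟨T, hT⟩ := eventually_atTop.1 (h1.and (eventually_ge_atTop 0))
  have hd : ∀ t, 0 ≤ t → HasDerivAt (fun t => f t - c / k * exp (k * t)) (h t * exp (k * t) - c / k * (exp (k * t) * k)) t := by
    intro t ht
    refine (hf t ht).sub (HasDerivAt.const_mul _ (HasDerivAt.exp ?_))
    simpa using (hasDerivAt_id t).const_mul k
  have anti : AntitoneOn (fun t => f t - c / k * exp (k * t)) (Ici T) := by
    apply antitoneOn_of_hasDerivWithinAt_nonpos (convex_Ici T)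
      (f' := fun t => h t * exp (k * t) - c / k * (exp (k * t) * k))
    · exact fun t ht => (hd t (hT t ht).2).continuousAt.continuousWithinAt
    · intro t ht
      rw [interior_Ici] at ht
      exact (hd t (hT t ht.le).2).hasDerivWithinAt
    · intro t ht
      rw [interior_Ici] at ht
      have e : c / k * (exp (k * t) * k) = c * exp (k * t) := by field_simp
      rw [e]
      have := mul_le_mul_of_nonneg_right (hT t ht.le).1.le (exp_pos (k * t)).le
      linarith
  set D := f T - c / k * exp (k * T)
  have lim : Tendsto (fun t => D * exp (-(k * t))) atTop (𝓝 (D * 0)) := by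
    apply Tendsto.const_mul
    exact tendsto_exp_neg_atTop_nhds_zero.comp (tendsto_id.const_mul_atTop hk)
  rw [mul_zero] at lim
  filter_upwards [lim.eventually_lt_const (half_pos hε), eventually_ge_atTop T] with t h2 h3
  have := anti (mem_Ici.2 le_rfl) (mem_Ici.2 h3) h3
  have h4 : f t ≤ D + c / k * exp (k * t) := by simp only at this; linarith
  have h5 := mul_le_mul_of_nonneg_right h4 (exp_pos (-(k * t))).le
  have e : (D + c / k * exp (k * t)) * exp (-(k * t)) = D * exp (-(k * t)) + c / k := by
    rw [add_mul, mul_assoc (c / k), ← exp_add, add_neg_cancel, exp_zero, mul_one]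
  have e2 : c / k = L / k + ε / 2 := by rw [hc]; field_simp
  rw [e, e2] at h5
  linarith

theorem mems_lim (f h : ℝ → ℝ) (k L : ℝ) (hk : 0 < k)
    (hf : ∀ t, 0 ≤ t → HasDerivAt f (h t * exp (k * t)) t)
    (hh : Tendsto h atTop (𝓝 L)) :
    Tendsto (fun t => f t * exp (-(k * t))) atTop (𝓝 (L / k)) := by
  rw [Metric.tendsto_nhds]
  intro ε hε
  have h2 := mems_upper (fun t => - f t) (fun t => - h t) k (-L) hk
    (fun t ht => by simpa using! (hf t ht).neg) hh.neg ε hε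
  filter_upwards [mems_upper f h k L hk hf hh ε hε, h2] with t h3 h4
  rw [Real.dist_eq, abs_lt]
  have : -L / k = - (L / k) := by ring
  rw [this] at h4
  constructor <;> linarith

theorem mems_lim2 (f h : ℝ → ℝ) (k L F : ℝ) (hk : 0 < k)
    (hf : ∀ t, 0 ≤ t → HasDerivAt f (h t * exp (-(k * t))) t)
    (hh : Tendsto h atTop (𝓝 L)) (hF : Tendsto f atTop (𝓝 F)) :
    Tendsto (fun t => (F - f t) * exp (k * t)) atTop (𝓝 (L / k)) := by
  have := HasDerivAt.lhopital_zero_atTop (f := fun t => F - f t) (g := fun t => exp (-(k * t)))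
    (f' := fun t => - (h t * exp (-(k * t)))) (g' := fun t => exp (-(k*t)) * (-k)) (l := 𝓝 (L / k))
    (by filter_upwards [eventually_ge_atTop 0] with t ht
        simpa using! (hf t ht).const_sub F)
    (Eventually.of_forall fun t => by
        refine HasDerivAt.exp ?_
        simpa using! ((hasDerivAt_id t).const_mul k).neg)
    (Eventually.of_forall fun t => by
        have := exp_pos (-(k*t))
        simp [hk.ne'])
    (by simpa using hF.const_sub F)
    (tendsto_exp_neg_atTop_nhds_zero.comp (tendsto_id.const_mul_atTop hk))
    (by
      refine (hh.div_const k).congr fun t => ?_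
      have := exp_pos (-(k*t))
      field_simp)
  refine this.congr fun t => ?_
  rw [exp_neg, div_inv_eq_mul]

theorem mems_inv (R : ℝ → ℝ) (h : ∀ t, ∃ R' : ℝ, 0 < R' ∧ HasDerivAt R R' t) :
    StrictMono R ∧ ∃ T : ℝ → ℝ, (∀ t, T (R t) = t) ∧
      ∀ t d, HasDerivAt R d t → HasDerivAt T d⁻¹ (R t) := by
  choose R' h0 h1 using h
  have hs : StrictMono R := strictMono_of_hasDerivAt_pos h1 h0
  have hcont : Continuous R := continuous_iff_continuousAt.2 fun t => (h1 t).continuousAt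
  have hoc : OrdConnected (range R) := (isPreconnected_range hcont).ordConnected
  have hopen : IsOpen (range R) := by
    rw [isOpen_iff_mem_nhds]
    rintro _ ⟨t, rfl⟩
    refine mem_of_superset (Icc_mem_nhds (hs (sub_one_lt t)) (hs (lt_add_one t))) ?_
    exact hoc.out ⟨_, rfl⟩ ⟨_, rfl⟩
  have hemb : Topology.IsOpenEmbedding R := ⟨hs.isEmbedding_of_ordConnected hoc, hopen⟩
  set e := hemb.toOpenPartialHomeomorph R with he
  have hinv : ∀ t, e.symm (R t) = t := fun t => e.left_inv (by simp [he])
  refine ⟨hs, e.symm, hinv, fun t d hd => ?_⟩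
  have hd0 : d ≠ 0 := by rw [hd.unique (h1 t)]; exact (h0 t).ne'
  exact e.hasDerivAt_symm (by simp [he]) hd0 (by rw [hinv]; exact hd)

theorem MEMS_quenching_exists (n : ℕ) (q : ℝ) (p : ℕ) (hp : 2 ≤ p) (hpe : Even p) :
    ∃ r₀ rmax : ℝ, 0 < r₀ ∧ r₀ < rmax ∧
      ∃ c_u c_u' : ℝ, 0 < c_u ∧ 0 < c_u' ∧
      ∃ u du : ℝ → ℝ,
        (∀ r ∈ Ico r₀ rmax, u r < 0) ∧
        (∀ r ∈ Ico r₀ rmax, HasDerivWithinAt u (du r) (Ico r₀ rmax) r) ∧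
        (∀ r ∈ Ico r₀ rmax,
          HasDerivWithinAt du
            (-(((n : ℝ) - 1) / r) * du r + r ^ q * u r ^ (-(p : ℤ)))
            (Ico r₀ rmax) r) ∧
        Tendsto (fun r => u r * (rmax - r) ^ (-(2 / ((p : ℝ) + 1))))
          (𝓝[<] rmax) (𝓝 (-c_u)) ∧
        Tendsto (fun r => du r * (rmax - r) ^ (((p : ℝ) - 1) / ((p : ℝ) + 1)))
          (𝓝[<] rmax) (𝓝 c_u') ∧
        Tendsto u (𝓝[<] rmax) (𝓝 0) ∧
        Tendsto du (𝓝[<] rmax) atTop := by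
  set a : ℝ := (n : ℝ) - 1 with ha
  set b : ℝ := 2 * a + q with hb
  set k : ℝ := (p : ℝ) - 1 with hk
  have hp2 : (2 : ℝ) ≤ p := by exact_mod_cast hp
  have hkpos : 0 < k := by linarith
  obtain ⟨R, m, hR0, hRd, hmain⟩ := mems_core a b k
  obtain ⟨hs, T, hTR, hTd⟩ := mems_inv R hRd
  have hcont : Continuous R := continuous_iff_continuousAt.2 fun t => by
    obtain ⟨d, -, hd⟩ := hRd t; exact hd.continuousAt
  have hR2 : ∀ t, R t ≤ 2 := fun t => (hs.monotone (le_max_left t 0)).trans (hmain _ (le_max_right t 0)).2.1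
  have hbdd : BddAbove (range R) := ⟨2, by rintro _ ⟨t, rfl⟩; exact hR2 t⟩
  set ρ := ⨆ t, R t with hρ
  have hRρ : Tendsto R atTop (𝓝 ρ) := tendsto_atTop_ciSup hs.monotone hbdd
  have hlt : ∀ t, R t < ρ := fun t => (hs (lt_add_one t)).trans_le (le_ciSup hbdd (t + 1))
  have h1ρ : 1 < ρ := hR0 ▸ hlt 0
  have hρ0 : 0 < ρ := by linarith
  have hsurj : ∀ N r, R N ≤ r → r < ρ → ∃ t, N ≤ t ∧ R t = r := by
    intro N r h1 h2
    obtain ⟨s, hs1, hs2⟩ := ((hRρ.eventually_const_lt h2).and (eventually_ge_atTop N)).exists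
    obtain ⟨t, ht, rfl⟩ := intermediate_value_Icc hs2 hcont.continuousOn ⟨h1, hs1.le⟩
    exact ⟨t, ht.1, rfl⟩
  -- transfer of limits
  have htrans : ∀ (f : ℝ → ℝ) (g : ℝ → ℝ) (l : Filter ℝ), (∀ t, 0 ≤ t → f (R t) = g t) →
      Tendsto g atTop l → Tendsto f (𝓝[<] ρ) l := by
    intro f g l hfg hg
    have hT : Tendsto T (𝓝[<] ρ) atTop := by
      rw [tendsto_atTop]
      intro N
      filter_upwards [Ioo_mem_nhdsLT (hlt N)] with r hr
      obtain ⟨t, ht, rfl⟩ := hsurj N r hr.1.le hr.2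
      rw [hTR]; exact ht
    refine (hg.comp hT).congr' ?_
    filter_upwards [Ioo_mem_nhdsLT (hlt 0)] with r hr
    obtain ⟨t, ht, rfl⟩ := hsurj 0 r hr.1.le hr.2
    simp only [Function.comp, hTR, hfg t ht]
  have hRpos : ∀ t, 0 ≤ t → 0 < R t := fun t ht => by
    have := hs.monotone ht; linarith
  -- asymptotics
  have hRpow : ∀ c : ℝ, Tendsto (fun t => R t ^ c) atTop (𝓝 (ρ ^ c)) := fun c =>
    hRρ.rpow_const (Or.inl hρ0.ne')
  have hm2 : Tendsto (fun t => m t ^ 2 * exp (-(k * t))) atTop (𝓝 (2 * ρ ^ b / k)) := by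
    refine mems_lim (fun t => m t ^ 2) (fun t => 2 * R t ^ b) k _ hkpos ?_ ((hRpow b).const_mul 2)
    intro t ht
    have h3 := (hmain t ht).2.2.2.pow 2
    have h4 := (hmain t ht).1
    convert! h3 using 1
    field_simp
    simp only [Nat.cast_ofNat, Nat.add_one_sub_one, pow_one]
    ring
  set κ : ℝ := √(2 * ρ ^ b / k) with hκ
  have hκpos : 0 < κ := by
    apply Real.sqrt_pos.2
    have := rpow_pos_of_pos hρ0 b
    positivity
  have hm1 : Tendsto (fun t => m t * exp (-(k / 2 * t))) atTop (𝓝 κ) := by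
    refine (hm2.sqrt).congr' ?_
    filter_upwards [eventually_ge_atTop 0] with t ht
    have e : m t ^ 2 * exp (-(k * t)) = (m t * exp (-(k / 2 * t))) ^ 2 := by
      rw [mul_pow, ← exp_nat_mul]; congr 2; push_cast; ring
    rw [e, Real.sqrt_sq (mul_pos (hmain t ht).1 (exp_pos _)).le]
  set j : ℝ := ((p : ℝ) + 1) / 2 with hj
  have hjpos : 0 < j := by positivity
  set C : ℝ := ρ ^ a * κ⁻¹ / j with hC
  have hCpos : 0 < C := by
    have := rpow_pos_of_pos hρ0 a
    positivity
  have hgap : Tendsto (fun t => (ρ - R t) * exp (j * t)) atTop (𝓝 C) := by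
    refine mems_lim2 R (fun t => R t ^ a * (m t * exp (-(k / 2 * t)))⁻¹) j _ ρ hjpos ?_
      ((hRpow a).mul (hm1.inv₀ hκpos.ne')) hRρ
    intro t ht
    convert! (hmain t ht).2.2.1 using 1
    have e : exp (-t) = (exp (-(k / 2 * t)))⁻¹ * exp (-(j * t)) := by
      rw [← exp_neg, ← exp_add]; congr 1; rw [hj, hk]; ring
    rw [e, mul_inv]; ring
  have hgp : ∀ c : ℝ, Tendsto (fun t => ((ρ - R t) * exp (j * t)) ^ c) atTop (𝓝 (C ^ c)) :=
    fun c => hgap.rpow_const (Or.inl hCpos.ne')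
  have hsplit : ∀ c t : ℝ, ((ρ - R t) * exp (j * t)) ^ c = (ρ - R t) ^ c * exp (j * t * c) := by
    intro c t
    rw [mul_rpow (by linarith [hlt t]) (exp_pos _).le, ← exp_mul]
  refine ⟨1, ρ, one_pos, h1ρ, C ^ (-(2 / ((p : ℝ) + 1))), κ * ρ ^ (-a) * C ^ (k / ((p : ℝ) + 1)),
    rpow_pos_of_pos hCpos _, mul_pos (mul_pos hκpos (rpow_pos_of_pos hρ0 _)) (rpow_pos_of_pos hCpos _),
    fun r => - exp (-(T r)), fun r => m (T r) * r ^ (-a), ?_, ?_, ?_, ?_, ?_, ?_, ?_⟩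
  · intro r _
    simpa using exp_pos _
  · intro r hr
    obtain ⟨t, ht, rfl⟩ := hsurj 0 r (hR0 ▸ hr.1) hr.2
    apply HasDerivAt.hasDerivWithinAt
    obtain ⟨hm, -, hd, -⟩ := hmain t ht
    have h3 := (hTd t _ hd).neg.exp.neg
    have hx := rpow_pos_of_pos (hRpos t ht) a
    convert! h3 using 1
    simp only [hTR]
    rw [rpow_neg (hRpos t ht).le]
    have := exp_pos (-t)
    simp only [Pi.neg_apply, hTR]
    field_simp
  · intro r hr
    obtain ⟨t, ht, rfl⟩ := hsurj 0 r (hR0 ▸ hr.1) hr.2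
    apply HasDerivAt.hasDerivWithinAt
    obtain ⟨hm, -, hd, hd2⟩ := hmain t ht
    have h3 : HasDerivAt (fun r => m (T r)) _ (R t) :=
      HasDerivAt.comp (R t) (by rw [hTR]; exact hd2) (hTd t _ hd)
    have h4 := h3.mul (Real.hasDerivAt_rpow_const (x := R t) (p := -a) (Or.inl (hRpos t ht).ne'))
    convert! h4 using 1
    simp only [hTR]
    have hx := rpow_pos_of_pos (hRpos t ht) a
    have hR := hRpos t ht
    have e1 : (- exp (-t)) ^ (-(p : ℤ)) = exp (k * t) * exp t := by
      rw [zpow_neg, zpow_natCast, hpe.neg_pow, ← exp_nat_mul, ← exp_neg, ← exp_add]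
      congr 1; rw [hk]; ring
    have e2 : R t ^ b = R t ^ a * R t ^ a * R t ^ q := by
      rw [← rpow_add hR, ← rpow_add hR]; congr 1; rw [hb]; ring
    have e3 : R t ^ (-a - 1) = (R t ^ a)⁻¹ * (R t)⁻¹ := by
      rw [rpow_sub hR, rpow_one, rpow_neg hR.le]; rfl
    rw [e1, e2, e3, rpow_neg hR.le, exp_neg]
    have := exp_pos t
    field_simp
    ring
  · refine htrans _ (fun t => -((ρ - R t) * exp (j * t)) ^ (-(2 / ((p : ℝ) + 1)))) _ ?_ (hgp _).neg
    intro t ht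
    simp only [hTR]
    rw [hsplit]
    have : j * t * (-(2 / ((p : ℝ) + 1))) = -t := by rw [hj]; field_simp
    rw [this]; ring
  · refine htrans _ (fun t => (m t * exp (-(k / 2 * t))) * R t ^ (-a) *
      ((ρ - R t) * exp (j * t)) ^ (k / ((p : ℝ) + 1))) _ ?_ ((hm1.mul (hRpow _)).mul (hgp _))
    intro t ht
    simp only [hTR]
    rw [hsplit]
    have : j * t * (k / ((p : ℝ) + 1)) = k / 2 * t := by rw [hj]; field_simp
    rw [this, exp_neg]
    have := exp_pos (k / 2 * t)
    field_simp
  · refine htrans _ (fun t => - exp (-t)) _ ?_ (by simpa using tendsto_exp_neg_atTop_nhds_zero.neg)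
    intro t ht
    simp only [hTR]
  · refine htrans _ (fun t => exp (k / 2 * t) * ((m t * exp (-(k / 2 * t))) * R t ^ (-a))) _ ?_ ?_
    · intro t ht
      simp only [hTR]
      rw [exp_neg]
      have := exp_pos (k / 2 * t)
      field_simp
    · refine Tendsto.atTop_mul_pos (mul_pos hκpos (rpow_pos_of_pos hρ0 (-a))) ?_ (hm1.mul (hRpow _))
      exact tendsto_exp_atTop.comp (tendsto_id.const_mul_atTop (half_pos hkpos))
end
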